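/- For k ≥ 3, the quantity (1-δ)^{-1}·√(πnδ/k)·λ(n,k,δ) converges to 1 as nδ/k → ∞; that is, for every ε > 0 there exists M such that for all n ≥ 2, all k ≥ 3, and all δ ∈ (0,1) with nδ/k ≥ M, one has |(1-δ)^{-1}·√(πnδ/k)·λ(n,k,δ) - 1| < ε. -/

import Mathlib

open Finset

/-- `perturbW k δ a j` is the probability that the `δ`-perturbation of the pure
action `a ∈ [k]` plays the action `j`: with probability `1-δ` play `a`, with
probability `δ` play uniformly in `[k]`. -/
noncomputable def perturbW (k : ℕ) (δ : ℝ) (a j : Fin k) : ℝ :=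
  (1 - δ) * (if j = a then 1 else 0) + δ / k

/-- Probability that the (independent) `δ`-perturbation of the pure profile `a`
realises as the pure profile `b`. -/
noncomputable def profW (n k : ℕ) (δ : ℝ) (a b : Fin n → Fin k) : ℝ :=
  ∏ i, perturbW k δ (a i) (b i)

/-- A game: payoffs lie in `[0,1]`. -/
def IsGame (n k : ℕ) (g : (Fin n → Fin k) → Fin n → ℝ) : Prop :=
  ∀ a i, g a i ∈ Set.Icc (0 : ℝ) 1

/-- The number of players taking action `j` in the profile `a`. -/
def actCount (n k : ℕ) (a : Fin n → Fin k) (j : Fin k) : ℕ :=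
  (Finset.univ.filter fun i => a i = j).card

/-- A game is anonymous if each player's payoff depends only on his own action and
on the number of players taking each action. -/
def IsAnonymous (n k : ℕ) (g : (Fin n → Fin k) → Fin n → ℝ) : Prop :=
  ∀ (a b : Fin n → Fin k) (i : Fin n), a i = b i →
    (∀ j, actCount n k a j = actCount n k b j) → g a i = g b i

/-- The `δ`-perturbed game `g^δ`. -/
noncomputable def perturbGame (n k : ℕ) (δ : ℝ) (g : (Fin n → Fin k) → Fin n → ℝ) :
    (Fin n → Fin k) → Fin n → ℝ :=
  fun a i => ∑ b : Fin n → Fin k, profW n k δ a b * g b i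

/-- The Lipschitz constant of a game: the largest change of some player's payoff
when a single opponent changes his action. -/
noncomputable def lipC (n k : ℕ) (g : (Fin n → Fin k) → Fin n → ℝ) : ℝ :=
  sSup {x | ∃ (i : Fin n) (a b : Fin n → Fin k), a i = b i ∧
    (Finset.univ.filter fun j => a j ≠ b j).card = 1 ∧ x = |g a i - g b i|}

/-- The worst-case Lipschitz constant of `δ`-perturbed `n`-player `k`-action
anonymous games. -/
noncomputable def lam (n k : ℕ) (δ : ℝ) : ℝ :=
  sSup {x | ∃ g : (Fin n → Fin k) → Fin n → ℝ,
    IsGame n k g ∧ IsAnonymous n k g ∧ x = lipC n k (perturbGame n k δ g)}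
/-- `walk r m z` is the probability that the lazy symmetric random walk on `ℤ` with
rate `r` (i.i.d. increments: `0` w.p. `1-r`, `±1` w.p. `r/2` each), started at `0`,
is at `z` after `m` steps; i.e. `P(S_m^r = z)`. -/
noncomputable def walk (r : ℝ) : ℕ → ℤ → ℝ
  | 0, z => if z = 0 then 1 else 0
  | m + 1, z => (1 - r) * walk r m z + r / 2 * walk r m (z - 1) + r / 2 * walk r m (z + 1)
/-- Averages `G` over adding one player with action distribution `w` to a vector of action
counts. -/
noncomputable def addPlayer {k : ℕ} (w : Fin k → ℝ) (G : (Fin k → ℕ) → ℝ) :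
    (Fin k → ℕ) → ℝ :=
  fun x => ∑ c, w c * G (x + Pi.single c 1)

/-- The uniform distribution on two actions `u` and `v`. -/
noncomputable def coin {k : ℕ} (u v : Fin k) (c : Fin k) : ℝ :=
  ((if c = u then 1 else 0) + (if c = v then 1 else 0)) / 2

/-- The effect on `F` of adding a player with action `u` rather than `v`. -/
def switchDiff {k : ℕ} (u v : Fin k) (F : (Fin k → ℕ) → ℝ) (x : Fin k → ℕ) : ℝ :=
  F (x + Pi.single u 1) - F (x + Pi.single v 1)

/-- One step of the binomial averaging of a sequence. -/
def mixStep (p : ℝ) (f : ℕ → ℝ) : ℕ → ℝ :=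
  fun q => p * f (q + 1) + (1 - p) * f q

/-- The largest point probability of the binomial distribution with parameters `q`, `1/2`. -/
noncomputable def modeProb (q : ℕ) : ℝ := (q.choose (q / 2) : ℝ) / 2 ^ q

theorem addPlayer_comm {k : ℕ} (w w' : Fin k → ℝ) (G : (Fin k → ℕ) → ℝ) :
    addPlayer w (addPlayer w' G) = addPlayer w' (addPlayer w G) := by
  funext x
  simp only [addPlayer, Finset.mul_sum]
  rw [Finset.sum_comm]
  refine Finset.sum_congr rfl fun c _ => Finset.sum_congr rfl fun d _ => ?_
  rw [add_right_comm x]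
  ring

theorem addPlayer_coin {k : ℕ} (u v : Fin k) (G : (Fin k → ℕ) → ℝ) (x : Fin k → ℕ) :
    addPlayer (coin u v) G x = (G (x + Pi.single u 1) + G (x + Pi.single v 1)) / 2 := by
  simp only [addPlayer, coin, add_div, add_mul, Finset.sum_add_distrib, ite_div, zero_div,
    ite_mul, zero_mul, Finset.sum_ite_eq', Finset.mem_univ, if_true]
  ring

theorem addPlayer_iterate_coin {k : ℕ} (u v : Fin k) (w : Fin k → ℝ) (G : (Fin k → ℕ) → ℝ)
    (q : ℕ) :
    (addPlayer (coin u v))^[q] (addPlayer w G) = addPlayer w ((addPlayer (coin u v))^[q] G) := by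
  induction q with
  | zero => rfl
  | succ q ih => rw [Function.iterate_succ_apply', ih, addPlayer_comm,
      ← Function.iterate_succ_apply' (addPlayer (coin u v))]

theorem iterate_addPlayer_coin_eq_sum {k : ℕ} (u v : Fin k) (G : (Fin k → ℕ) → ℝ) (q : ℕ)
    (x : Fin k → ℕ) :
    (addPlayer (coin u v))^[q] G x = (∑ s ∈ Finset.range (q + 1),
      (q.choose s : ℝ) * G (x + s • Pi.single u 1 + (q - s) • Pi.single v 1)) / 2 ^ q := by
  induction q generalizing x with
  | zero => simp
  | succ q ih =>
    have hpascal : ∑ s ∈ Finset.range (q + 1 + 1), ((q + 1).choose s : ℝ) *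
          G (x + s • Pi.single u 1 + (q + 1 - s) • Pi.single v 1)
        = ∑ s ∈ Finset.range (q + 1), (q.choose s : ℝ) *
            G (x + s • Pi.single u 1 + (q + 1 - s) • Pi.single v 1)
          + ∑ s ∈ Finset.range (q + 1), (q.choose s : ℝ) *
            G (x + (s + 1) • Pi.single u 1 + (q - s) • Pi.single v 1) :=
      Finset.sum_choose_succ_mul
        (fun i j => G (x + i • (Pi.single u 1 : Fin k → ℕ) + j • (Pi.single v 1 : Fin k → ℕ))) q
    rw [Function.iterate_succ_apply', addPlayer_coin, ih, ih, hpascal]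
    have h1 : ∀ s, G (x + Pi.single u 1 + s • Pi.single u 1 + (q - s) • Pi.single v 1)
        = G (x + (s + 1) • Pi.single u 1 + (q - s) • Pi.single v 1) := by
      intro s
      congr 1
      rw [succ_nsmul]
      abel
    have h2 : ∀ s ∈ Finset.range (q + 1),
        (q.choose s : ℝ) * G (x + Pi.single v 1 + s • Pi.single u 1 + (q - s) • Pi.single v 1)
        = (q.choose s : ℝ) * G (x + s • Pi.single u 1 + (q + 1 - s) • Pi.single v 1) := by
      intro s hs
      congr 2
      rw [Nat.sub_add_comm (Nat.lt_succ_iff.mp (Finset.mem_range.mp hs)), succ_nsmul]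
      abel
    simp only [h1]
    rw [Finset.sum_congr rfl h2, pow_succ]
    field_simp
    ring

theorem switchDiff_iterate_coin {k : ℕ} (u v : Fin k) (G : (Fin k → ℕ) → ℝ) (q : ℕ)
    (x : Fin k → ℕ) :
    switchDiff u v ((addPlayer (coin u v))^[q] G) x = (∑ s ∈ Finset.range (q + 1),
      (q.choose s : ℝ) * (G (x + (s + 1) • Pi.single u 1 + (q + 1 - (s + 1)) • Pi.single v 1)
        - G (x + s • Pi.single u 1 + (q + 1 - s) • Pi.single v 1))) / 2 ^ q := by
  rw [switchDiff, iterate_addPlayer_coin_eq_sum, iterate_addPlayer_coin_eq_sum, ← sub_div,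
    ← Finset.sum_sub_distrib]
  congr 1
  refine Finset.sum_congr rfl fun s hs => ?_
  rw [← mul_sub]
  congr 3
  · rw [Nat.add_sub_add_right, succ_nsmul]
    abel
  · rw [Nat.sub_add_comm (Nat.lt_succ_iff.mp (Finset.mem_range.mp hs)), succ_nsmul]
    abel

/-- Summation by parts against a unimodal weight. -/
theorem abs_sum_mul_diff_le_of_unimodal {c F : ℕ → ℝ} {m L : ℕ} (hc : ∀ s, 0 ≤ c s)
    (hup : ∀ s < m, c s ≤ c (s + 1)) (hdown : ∀ s, m ≤ s → c (s + 1) ≤ c s)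
    (hF : ∀ t, F t ∈ Set.Icc (0 : ℝ) 1) (hL : m ≤ L) :
    |∑ s ∈ Finset.range L, c s * (F (s + 1) - F s)| ≤ c m := by
  have hinc : ∀ r ≤ m, -(c r * (1 - F r)) ≤ ∑ s ∈ Finset.range r, c s * (F (s + 1) - F s) ∧
      ∑ s ∈ Finset.range r, c s * (F (s + 1) - F s) ≤ c r * F r := by
    intro r hr
    induction r with
    | zero =>
      simpa using ⟨mul_nonneg (hc 0) (sub_nonneg.2 (hF 0).2), mul_nonneg (hc 0) (hF 0).1⟩
    | succ r ih =>
      obtain ⟨h1, h2⟩ := ih (by omega)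
      rw [Finset.sum_range_succ]
      have h := hup r (by omega)
      have h3 := mul_le_mul_of_nonneg_right h (hF (r + 1)).1
      have h4 := mul_le_mul_of_nonneg_right h (sub_nonneg.2 (hF (r + 1)).2)
      constructor <;> linarith
  have hdec : -c m + c L * F L ≤ ∑ s ∈ Finset.range L, c s * (F (s + 1) - F s) ∧
      ∑ s ∈ Finset.range L, c s * (F (s + 1) - F s) ≤ c m - c L * (1 - F L) := by
    induction L, hL using Nat.le_induction with
    | base =>
      obtain ⟨h1, h2⟩ := hinc m le_rfl
      constructor <;> linarith
    | succ r hr ih =>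
      obtain ⟨h1, h2⟩ := ih
      rw [Finset.sum_range_succ]
      have h := hdown r hr
      have h3 := mul_le_mul_of_nonneg_right h (hF (r + 1)).1
      have h4 := mul_le_mul_of_nonneg_right h (sub_nonneg.2 (hF (r + 1)).2)
      constructor <;> linarith
  rw [abs_le]
  have h3 := mul_nonneg (hc L) (hF L).1
  have h4 := mul_nonneg (hc L) (sub_nonneg.2 (hF L).2)
  constructor <;> linarith [hdec.1, hdec.2]

theorem choose_succ_le_of_half_le {q s : ℕ} (h : q / 2 ≤ s) :
    q.choose (s + 1) ≤ q.choose s := by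
  rcases lt_or_ge s q with hs | hs
  · have h1 := Nat.choose_succ_right_eq q s
    have h2 : q - s ≤ s + 1 := by omega
    have h3 : q.choose (s + 1) * (s + 1) ≤ q.choose s * (s + 1) :=
      h1.trans_le (Nat.mul_le_mul_left _ h2)
    exact Nat.le_of_mul_le_mul_right h3 (Nat.succ_pos s)
  · simp [Nat.choose_eq_zero_of_lt (Nat.lt_succ_of_le hs)]

theorem abs_switchDiff_iterate_coin_le {k : ℕ} (u v : Fin k) {G : (Fin k → ℕ) → ℝ}
    (hG : ∀ x, G x ∈ Set.Icc (0 : ℝ) 1) (q : ℕ) (x : Fin k → ℕ) :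
    |switchDiff u v ((addPlayer (coin u v))^[q] G) x| ≤ modeProb q := by
  rw [switchDiff_iterate_coin, abs_div, abs_of_pos (by positivity : (0 : ℝ) < 2 ^ q), modeProb]
  have h := abs_sum_mul_diff_le_of_unimodal (c := fun s => (q.choose s : ℝ))
    (F := fun t => G (x + t • Pi.single u 1 + (q + 1 - t) • Pi.single v 1)) (m := q / 2)
    (L := q + 1) (fun s => Nat.cast_nonneg _)
    (fun s hs => Nat.cast_le.2 (Nat.choose_le_succ_of_lt_half_left hs))
    (fun s hs => Nat.cast_le.2 (choose_succ_le_of_half_le hs)) (fun t => hG _) (by omega)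
  exact div_le_div_of_nonneg_right h (by positivity)

theorem switchDiff_iterate_coin_majority {k : ℕ} {u v : Fin k} (huv : u ≠ v)
    {G : (Fin k → ℕ) → ℝ} {x : Fin k → ℕ} {y z : ℕ}
    (hG : ∀ x : Fin k → ℕ, G x = if x v + z < x u + y then 1 else 0)
    (hx : x v + z = x u + y) (q : ℕ) :
    switchDiff u v ((addPlayer (coin u v))^[q] G) x = modeProb q := by
  rw [switchDiff_iterate_coin, modeProb]
  congr 1
  have hval : ∀ t ≤ q + 1, G (x + t • Pi.single u 1 + (q + 1 - t) • Pi.single v 1)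
      = if q + 1 - t < t then 1 else 0 := by
    intro t ht
    rw [hG]
    simp only [Pi.add_apply, Pi.smul_apply, Pi.single_eq_same, Pi.single_eq_of_ne huv,
      Pi.single_eq_of_ne huv.symm, smul_eq_mul, mul_one, mul_zero, add_zero]
    congr 1
    rw [eq_iff_iff]
    omega
  have hsum := Finset.sum_eq_single_of_mem (s := Finset.range (q + 1))
    (f := fun s => (q.choose s : ℝ) *
      (G (x + (s + 1) • Pi.single u 1 + (q + 1 - (s + 1)) • Pi.single v 1)
        - G (x + s • Pi.single u 1 + (q + 1 - s) • Pi.single v 1)))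
    ((q + 1) / 2) (by simp; omega) (fun s hs hne => ?_)
  · rw [hsum, hval _ (by omega), hval _ (by omega), if_pos (by omega), if_neg (by omega)]
    have : q.choose ((q + 1) / 2) = q.choose (q / 2) :=
      Nat.choose_symm_of_eq_add (by omega)
    simp [this]
  · rw [Finset.mem_range] at hs
    rw [hval _ (by omega), hval _ (by omega)]
    by_cases h : q + 1 - (s + 1) < s + 1
    · rw [if_pos h, if_pos (by omega)]
      simp
    · rw [if_neg h, if_neg (by omega)]
      simp

theorem abs_switchDiff_addPlayer_le {k : ℕ} {δ : ℝ} (hδ0 : 0 ≤ δ) (hδ1 : δ ≤ 1)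
    {u v : Fin k} (huv : u ≠ v) (a : Fin k) {G : (Fin k → ℕ) → ℝ} {f : ℕ → ℝ}
    (hf : ∀ q x, |switchDiff u v ((addPlayer (coin u v))^[q] G) x| ≤ f q) (q : ℕ)
    (x : Fin k → ℕ) :
    |switchDiff u v ((addPlayer (coin u v))^[q] (addPlayer (perturbW k δ a) G)) x|
      ≤ mixStep (2 * δ / k) f q := by
  have hk : (0 : ℝ) < k := by exact_mod_cast u.pos
  set r : Fin k → ℝ := fun c => perturbW k δ a c - 2 * δ / k * coin u v c with hr
  have hr0 : ∀ c, 0 ≤ r c := by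
    intro c
    have h1 : 0 ≤ (1 - δ) * (if c = a then 1 else 0 : ℝ) :=
      mul_nonneg (by linarith) (by split_ifs <;> norm_num)
    have h2 : coin u v c ≤ 1 / 2 := by
      unfold coin
      by_cases hu : c = u
      · simp [hu, huv]
      · by_cases hv : c = v <;> simp [hu, hv, huv.symm]
    have h3 : 2 * δ / k * coin u v c ≤ 2 * δ / k * (1 / 2) := by gcongr
    have h4 : 2 * δ / k * (1 / 2) = δ / k := by ring
    simp only [hr, perturbW]
    linarith
  have hr1 : ∑ c, r c = 1 - 2 * δ / k := by
    simp only [hr, perturbW, coin, Finset.sum_sub_distrib, Finset.sum_add_distrib,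
      ← Finset.mul_sum, ← Finset.sum_div, Finset.sum_ite_eq', Finset.mem_univ, if_true,
      Finset.sum_const, Finset.card_univ, Fintype.card_fin, nsmul_eq_mul]
    field_simp
    ring
  have hsplit : switchDiff u v ((addPlayer (coin u v))^[q] (addPlayer (perturbW k δ a) G)) x
      = 2 * δ / k * switchDiff u v ((addPlayer (coin u v))^[q + 1] G) x
        + ∑ c, r c * switchDiff u v ((addPlayer (coin u v))^[q] G) (x + Pi.single c 1) := by
    rw [addPlayer_iterate_coin, Function.iterate_succ_apply']
    simp only [switchDiff, addPlayer, Finset.mul_sum, ← Finset.sum_sub_distrib,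
      ← Finset.sum_add_distrib]
    refine Finset.sum_congr rfl fun c _ => ?_
    simp only [hr, add_right_comm x _ (Pi.single c 1)]
    ring
  rw [hsplit, mixStep, ← hr1, Finset.sum_mul]
  refine (abs_add_le _ _).trans (add_le_add ?_ ?_)
  · rw [abs_mul, abs_of_nonneg (by positivity)]
    exact mul_le_mul_of_nonneg_left (hf _ _) (by positivity)
  · refine (Finset.abs_sum_le_sum_abs _ _).trans (Finset.sum_le_sum fun c _ => ?_)
    rw [abs_mul, abs_of_nonneg (hr0 c)]
    exact mul_le_mul_of_nonneg_left (hf _ _) (hr0 c)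

theorem perturbW_nonneg {k : ℕ} {δ : ℝ} (hδ0 : 0 ≤ δ) (hδ1 : δ ≤ 1) (a c : Fin k) :
    0 ≤ perturbW k δ a c :=
  add_nonneg (mul_nonneg (sub_nonneg.2 hδ1) (by split_ifs <;> norm_num)) (by positivity)

theorem sum_perturbW {k : ℕ} (δ : ℝ) (a : Fin k) : ∑ c, perturbW k δ a c = 1 := by
  have hk : (0 : ℝ) < k := by exact_mod_cast a.pos
  simp only [perturbW, Finset.sum_add_distrib, ← Finset.mul_sum, Finset.sum_ite_eq',
    Finset.mem_univ, if_true, Finset.sum_const, Finset.card_univ, Fintype.card_fin,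
    nsmul_eq_mul]
  field_simp
  ring

theorem addPlayer_perturbW_of_invariant {k : ℕ} {δ : ℝ} {u v a : Fin k} (huv : u ≠ v)
    (hau : a ≠ u) (hav : a ≠ v) {G : (Fin k → ℕ) → ℝ}
    (hG : ∀ c, c ≠ u → c ≠ v → ∀ x, G (x + Pi.single c 1) = G x) (x : Fin k → ℕ) :
    addPlayer (perturbW k δ a) G x
      = 2 * δ / k * addPlayer (coin u v) G x + (1 - 2 * δ / k) * G x := by
  have hk : (0 : ℝ) < k := by exact_mod_cast u.pos
  have hterm : ∀ c, perturbW k δ a c * G (x + Pi.single c 1)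
      = perturbW k δ a c * G x + (if c = u then δ / k * (G (x + Pi.single u 1) - G x) else 0)
        + (if c = v then δ / k * (G (x + Pi.single v 1) - G x) else 0) := by
    intro c
    by_cases hu : c = u
    · subst hu
      simp only [perturbW, if_neg hau.symm, if_neg huv, if_true]
      ring
    · by_cases hv : c = v
      · subst hv
        simp only [perturbW, if_neg hav.symm, if_neg hu, if_true]
        ring
      · simp [hu, hv, hG c hu hv]
  rw [addPlayer_coin]
  simp only [addPlayer, hterm, Finset.sum_add_distrib, ← Finset.sum_mul, sum_perturbW,
    Finset.sum_ite_eq', Finset.mem_univ, if_true]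
  field_simp
  ring

theorem iterate_coin_invariant {k : ℕ} {u v c : Fin k} {G : (Fin k → ℕ) → ℝ}
    (hG : ∀ x, G (x + Pi.single c 1) = G x) (q : ℕ) (x : Fin k → ℕ) :
    (addPlayer (coin u v))^[q] G (x + Pi.single c 1) = (addPlayer (coin u v))^[q] G x := by
  induction q generalizing x with
  | zero => exact hG x
  | succ q ih =>
    rw [Function.iterate_succ_apply', addPlayer_coin, addPlayer_coin,
      add_right_comm x _ (Pi.single u 1), add_right_comm x _ (Pi.single v 1), ih, ih]

theorem switchDiff_addPlayer_of_invariant {k : ℕ} {δ : ℝ} {u v a : Fin k} (huv : u ≠ v)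
    (hau : a ≠ u) (hav : a ≠ v) {G : (Fin k → ℕ) → ℝ}
    (hG : ∀ c, c ≠ u → c ≠ v → ∀ x, G (x + Pi.single c 1) = G x) (q : ℕ) (x : Fin k → ℕ) :
    switchDiff u v ((addPlayer (coin u v))^[q] (addPlayer (perturbW k δ a) G)) x
      = mixStep (2 * δ / k) (fun q => switchDiff u v ((addPlayer (coin u v))^[q] G) x) q := by
  have hinv : ∀ c, c ≠ u → c ≠ v → ∀ x, (addPlayer (coin u v))^[q] G (x + Pi.single c 1)
      = (addPlayer (coin u v))^[q] G x :=
    fun c hu hv => iterate_coin_invariant (hG c hu hv) q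
  rw [addPlayer_iterate_coin]
  simp only [mixStep, switchDiff, addPlayer_perturbW_of_invariant huv hau hav hinv,
    Function.iterate_succ_apply']
  ring

/-- Averages `G` over adding independent players with action distributions `w l`. -/
noncomputable def addPlayers {N k : ℕ} (w : Fin N → Fin k → ℝ) (G : (Fin k → ℕ) → ℝ) :
    (Fin k → ℕ) → ℝ :=
  fun x => ∑ c : Fin N → Fin k, (∏ l, w l (c l)) * G (x + ∑ l, Pi.single (c l) 1)

theorem addPlayers_zero {k : ℕ} (w : Fin 0 → Fin k → ℝ) (G : (Fin k → ℕ) → ℝ) :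
    addPlayers w G = G := by
  funext x
  simp [addPlayers]

theorem addPlayers_succ {N k : ℕ} (w : Fin (N + 1) → Fin k → ℝ) (G : (Fin k → ℕ) → ℝ) :
    addPlayers w G = addPlayer (w 0) (addPlayers (fun l => w l.succ) G) := by
  funext x
  simp only [addPlayers, addPlayer]
  rw [← (Fin.consEquiv fun _ : Fin (N + 1) => Fin k).sum_comp, Fintype.sum_prod_type]
  simp only [Fin.consEquiv_apply, Fin.prod_univ_succ, Fin.sum_univ_succ, Fin.cons_zero,
    Fin.cons_succ, Finset.mul_sum, mul_assoc, add_assoc]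

theorem abs_switchDiff_addPlayers_le {N k : ℕ} {δ : ℝ} (hδ0 : 0 ≤ δ) (hδ1 : δ ≤ 1)
    {u v : Fin k} (huv : u ≠ v) (a : Fin N → Fin k) {G : (Fin k → ℕ) → ℝ}
    (hG : ∀ x, G x ∈ Set.Icc (0 : ℝ) 1) (q : ℕ) (x : Fin k → ℕ) :
    |switchDiff u v ((addPlayer (coin u v))^[q]
        (addPlayers (fun l => perturbW k δ (a l)) G)) x|
      ≤ (mixStep (2 * δ / k))^[N] modeProb q := by
  induction N generalizing q x with
  | zero =>
    rw [addPlayers_zero]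
    exact abs_switchDiff_iterate_coin_le u v hG q x
  | succ N ih =>
    rw [addPlayers_succ, Function.iterate_succ_apply']
    exact abs_switchDiff_addPlayer_le hδ0 hδ1 huv _ (ih fun l => a l.succ) q x

theorem switchDiff_addPlayers_majority {k : ℕ} {u v a : Fin k} (huv : u ≠ v) (hau : a ≠ u)
    (hav : a ≠ v) {G : (Fin k → ℕ) → ℝ} {x : Fin k → ℕ} {y z : ℕ}
    (hG : ∀ x : Fin k → ℕ, G x = if x v + z < x u + y then 1 else 0)
    (hx : x v + z = x u + y) (δ : ℝ) (N q : ℕ) :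
    switchDiff u v ((addPlayer (coin u v))^[q]
        (addPlayers (fun _ : Fin N => perturbW k δ a) G)) x
      = (mixStep (2 * δ / k))^[N] modeProb q := by
  have hinv : ∀ N : ℕ, ∀ c, c ≠ u → c ≠ v → ∀ x,
      addPlayers (fun _ : Fin N => perturbW k δ a) G (x + Pi.single c 1)
        = addPlayers (fun _ : Fin N => perturbW k δ a) G x := by
    intro N c hu hv x
    simp only [addPlayers]
    refine Finset.sum_congr rfl fun d _ => ?_
    rw [hG, hG]
    simp [hu.symm, hv.symm]
  induction N generalizing q with
  | zero =>
    rw [addPlayers_zero]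
    exact switchDiff_iterate_coin_majority huv hG hx q
  | succ N ih =>
    rw [addPlayers_succ, Function.iterate_succ_apply',
      switchDiff_addPlayer_of_invariant huv hau hav (hinv N)]
    simp only [ih]

theorem perturbGame_eq_sum {N k : ℕ} (δ : ℝ) {g : (Fin (N + 2) → Fin k) → Fin (N + 2) → ℝ}
    (σ : Equiv.Perm (Fin (N + 2))) {G : Fin k → (Fin k → ℕ) → ℝ}
    (hG : ∀ c, g c (σ 0) = G (c (σ 0)) (∑ l, Pi.single (c l) 1))
    (a : Fin (N + 2) → Fin k) :
    perturbGame (N + 2) k δ g a (σ 0) = ∑ α, perturbW k δ (a (σ 0)) α *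
      addPlayer (perturbW k δ (a (σ 1)))
        (addPlayers (fun l => perturbW k δ (a (σ l.succ.succ))) (G α)) (Pi.single α 1) := by
  have hw : ∀ α, addPlayer (perturbW k δ (a (σ 1)))
        (addPlayers (fun l => perturbW k δ (a (σ l.succ.succ))) (G α))
      = addPlayers (fun l => perturbW k δ (a (σ l.succ))) (G α) := by
    intro α
    rw [addPlayers_succ]
    rfl
  simp only [hw, perturbGame, profW]
  rw [← (Equiv.arrowCongr σ (Equiv.refl (Fin k))).sum_comp]
  have hterm : ∀ c : Fin (N + 2) → Fin k,
      (∏ l, perturbW k δ (a l) (Equiv.arrowCongr σ (Equiv.refl (Fin k)) c l))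
          * g (Equiv.arrowCongr σ (Equiv.refl (Fin k)) c) (σ 0)
        = (∏ l, perturbW k δ (a (σ l)) (c l)) * G (c 0) (∑ l, Pi.single (c l) 1) := by
    intro c
    rw [hG, ← Equiv.prod_comp σ, ← Equiv.sum_comp σ]
    simp
  simp only [hterm]
  rw [← (Fin.consEquiv fun _ : Fin (N + 2) => Fin k).sum_comp, Fintype.sum_prod_type]
  simp only [Fin.consEquiv_apply, Fin.prod_univ_succ (n := N + 1),
    Fin.sum_univ_succ (n := N + 1), Fin.cons_zero, Fin.cons_succ, addPlayers, Finset.mul_sum,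
    mul_assoc]

theorem perturbGame_sub_eq {N k : ℕ} (δ : ℝ) {g : (Fin (N + 2) → Fin k) → Fin (N + 2) → ℝ}
    (σ : Equiv.Perm (Fin (N + 2))) {G : Fin k → (Fin k → ℕ) → ℝ}
    (hG : ∀ c, g c (σ 0) = G (c (σ 0)) (∑ l, Pi.single (c l) 1))
    {a b : Fin (N + 2) → Fin k} (hab : ∀ l, l ≠ σ 1 → a l = b l) :
    perturbGame (N + 2) k δ g a (σ 0) - perturbGame (N + 2) k δ g b (σ 0)
      = (1 - δ) * ∑ α, perturbW k δ (a (σ 0)) α * switchDiff (a (σ 1)) (b (σ 1))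
        (addPlayers (fun l => perturbW k δ (a (σ l.succ.succ))) (G α)) (Pi.single α 1) := by
  rw [perturbGame_eq_sum δ σ hG, perturbGame_eq_sum δ σ hG, ← hab (σ 0) (by simp)]
  have h2 : ∀ l : Fin N, b (σ l.succ.succ) = a (σ l.succ.succ) := by
    intro l
    refine (hab _ fun h => ?_).symm
    have := σ.injective h
    exact Fin.succ_ne_zero l (Fin.succ_injective _ this)
  simp only [h2]
  rw [← Finset.sum_sub_distrib, Finset.mul_sum]
  refine Finset.sum_congr rfl fun α _ => ?_
  rw [← mul_sub, mul_left_comm (1 - δ)]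
  congr 1
  simp only [addPlayer, switchDiff, perturbW, add_mul, Finset.sum_add_distrib, mul_assoc,
    ite_mul, one_mul, zero_mul, mul_ite, mul_zero, Finset.sum_ite_eq', Finset.mem_univ, if_true]
  ring

theorem sum_single_apply_eq_actCount {n k : ℕ} (c : Fin n → Fin k) (j : Fin k) :
    (∑ l, Pi.single (c l) 1 : Fin k → ℕ) j = actCount n k c j := by
  rw [Finset.sum_apply, actCount, Finset.card_filter]
  refine Finset.sum_congr rfl fun l _ => ?_
  simp only [Pi.single_apply, eq_comm (a := j)]

theorem IsAnonymous.exists_count_representation {n k : ℕ}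
    {g : (Fin n → Fin k) → Fin n → ℝ} (hg : IsGame n k g) (ha : IsAnonymous n k g)
    (i : Fin n) :
    ∃ G : Fin k → (Fin k → ℕ) → ℝ, (∀ α x, G α x ∈ Set.Icc (0 : ℝ) 1) ∧
      ∀ c, g c i = G (c i) (∑ l, Pi.single (c l) 1) := by
  classical
  have hfac : Function.FactorsThrough (fun c => g c i)
      (fun c : Fin n → Fin k => (c i, (∑ l, Pi.single (c l) 1 : Fin k → ℕ))) := by
    intro c d hcd
    obtain ⟨h1, h2⟩ := Prod.mk.inj hcd
    refine ha c d i h1 fun j => ?_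
    rw [← sum_single_apply_eq_actCount, h2, sum_single_apply_eq_actCount]
  refine ⟨fun α x => Function.extend
    (fun c : Fin n → Fin k => (c i, (∑ l, Pi.single (c l) 1 : Fin k → ℕ)))
    (fun c => g c i) 0 (α, x), fun α x => ?_, fun c => ?_⟩
  · simp only [Function.extend_def]
    split_ifs
    · exact hg _ _
    · simp
  · exact (hfac.extend_apply 0 c).symm

theorem exists_perm_zero_one {N : ℕ} {i j : Fin (N + 2)} (hij : i ≠ j) :
    ∃ σ : Equiv.Perm (Fin (N + 2)), σ 0 = i ∧ σ 1 = j := by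
  refine ⟨(Equiv.swap 1 (Equiv.swap 0 i j)).trans (Equiv.swap 0 i), ?_, ?_⟩
  · have h : Equiv.swap 0 i j ≠ 0 := by
      intro h
      rw [Equiv.swap_apply_eq_iff, Equiv.swap_apply_left] at h
      exact hij h.symm
    rw [Equiv.trans_apply, Equiv.swap_apply_of_ne_of_ne (by simp) h.symm,
      Equiv.swap_apply_left]
  · simp

theorem mixStep_iterate_nonneg {p : ℝ} (hp0 : 0 ≤ p) (hp1 : p ≤ 1) {f : ℕ → ℝ}
    (hf : ∀ q, 0 ≤ f q) (N q : ℕ) : 0 ≤ (mixStep p)^[N] f q := by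
  induction N generalizing q with
  | zero => exact hf q
  | succ N ih =>
    rw [Function.iterate_succ_apply']
    exact add_nonneg (mul_nonneg hp0 (ih _)) (mul_nonneg (sub_nonneg.2 hp1) (ih _))

theorem abs_perturbGame_sub_le {N k : ℕ} {δ : ℝ} (hδ0 : 0 ≤ δ) (hδ1 : δ ≤ 1)
    {g : (Fin (N + 2) → Fin k) → Fin (N + 2) → ℝ} (hg : IsGame (N + 2) k g)
    (ha : IsAnonymous (N + 2) k g) {i : Fin (N + 2)} {a b : Fin (N + 2) → Fin k}
    (hi : a i = b i) (hab : (Finset.univ.filter fun j => a j ≠ b j).card = 1) :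
    |perturbGame (N + 2) k δ g a i - perturbGame (N + 2) k δ g b i|
      ≤ (1 - δ) * (mixStep (2 * δ / k))^[N] modeProb 0 := by
  obtain ⟨j, hj⟩ := Finset.card_eq_one.1 hab
  have hmem : ∀ l, a l ≠ b l ↔ l = j := fun l => by
    rw [← Finset.mem_singleton, ← hj]
    simp
  obtain ⟨σ, rfl, rfl⟩ := exists_perm_zero_one
    (show i ≠ j from fun h => (hmem i).2 h hi)
  obtain ⟨G, hG, hgG⟩ := ha.exists_count_representation hg (σ 0)
  rw [perturbGame_sub_eq δ σ hgG (fun l hl => by_contra fun h => hl ((hmem l).1 h)), abs_mul,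
    abs_of_nonneg (sub_nonneg.2 hδ1)]
  refine mul_le_mul_of_nonneg_left ?_ (sub_nonneg.2 hδ1)
  rw [← one_mul ((mixStep (2 * δ / k))^[N] modeProb 0), ← sum_perturbW δ (a (σ 0)),
    Finset.sum_mul]
  refine (Finset.abs_sum_le_sum_abs _ _).trans (Finset.sum_le_sum fun α _ => ?_)
  rw [abs_mul, abs_of_nonneg (perturbW_nonneg hδ0 hδ1 _ _)]
  exact mul_le_mul_of_nonneg_left
    (abs_switchDiff_addPlayers_le hδ0 hδ1 ((hmem _).2 rfl) _ (hG α) 0 _)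
    (perturbW_nonneg hδ0 hδ1 _ _)

/-- The game in which a player's payoff records whether, among the opponents, action `u` is
strictly more frequent than action `v`. -/
noncomputable def majorityGame (n : ℕ) {k : ℕ} (u v : Fin k) (c : Fin n → Fin k) (i : Fin n) :
    ℝ :=
  if actCount n k c v + (if c i = u then 1 else 0) < actCount n k c u + (if c i = v then 1 else 0)
  then 1 else 0

theorem isGame_majorityGame (n : ℕ) {k : ℕ} (u v : Fin k) :
    IsGame n k (majorityGame n u v) := by
  intro c i
  unfold majorityGame
  split_ifs <;> simp

theorem isAnonymous_majorityGame (n : ℕ) {k : ℕ} (u v : Fin k) :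
    IsAnonymous n k (majorityGame n u v) := by
  intro a b i hi hab
  simp only [majorityGame, hi, hab]

theorem perturbGame_majorityGame_sub (N : ℕ) {k : ℕ} (δ : ℝ) {u v a : Fin k} (huv : u ≠ v)
    (hau : a ≠ u) (hav : a ≠ v) :
    perturbGame (N + 2) k δ (majorityGame (N + 2) u v)
        (Function.update (fun _ => a) 1 u) 0
      - perturbGame (N + 2) k δ (majorityGame (N + 2) u v)
        (Function.update (fun _ => a) 1 v) 0
      = (1 - δ) * (mixStep (2 * δ / k))^[N] modeProb 0 := by
  have h := perturbGame_sub_eq δ (g := majorityGame (N + 2) u v) (Equiv.refl (Fin (N + 2)))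
    (G := fun α x => if x v + (if α = u then 1 else 0) < x u + (if α = v then 1 else 0)
      then 1 else 0)
    (fun c => by simp only [majorityGame, sum_single_apply_eq_actCount])
    (a := Function.update (fun _ => a) 1 u) (b := Function.update (fun _ => a) 1 v)
    (fun l (hl : l ≠ 1) => by rw [Function.update_of_ne hl, Function.update_of_ne hl])
  simp only [Equiv.refl_apply, Function.update_self] at h
  rw [h]
  congr 1
  have hne : ∀ l : Fin N, (l.succ.succ : Fin (N + 2)) ≠ 1 := fun l hl =>
    Fin.succ_ne_zero l (Fin.succ_injective _ hl)
  simp only [Function.update_of_ne (hne _)]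
  have hmode : ∀ α, switchDiff u v (addPlayers (fun _ : Fin N => perturbW k δ a) fun x =>
      if x v + (if α = u then 1 else 0) < x u + (if α = v then 1 else 0) then 1 else 0)
      (Pi.single α 1) = (mixStep (2 * δ / k))^[N] modeProb 0 := by
    intro α
    refine switchDiff_addPlayers_majority huv hau hav (fun x => rfl) ?_ δ N 0
    simp only [Pi.single_apply, eq_comm (a := α)]
    exact add_comm _ _
  simp only [hmode]
  rw [← Finset.sum_mul, sum_perturbW, one_mul]

theorem lam_eq {N k : ℕ} {δ : ℝ} (hk : 3 ≤ k) (hδ0 : 0 ≤ δ) (hδ1 : δ ≤ 1) :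
    lam (N + 2) k δ = (1 - δ) * (mixStep (2 * δ / k))^[N] modeProb 0 := by
  have hk' : (3 : ℝ) ≤ k := by exact_mod_cast hk
  have hB : 0 ≤ (1 - δ) * (mixStep (2 * δ / k))^[N] modeProb 0 := by
    refine mul_nonneg (sub_nonneg.2 hδ1) (mixStep_iterate_nonneg (by positivity) ?_
      (fun q => by unfold modeProb; positivity) _ _)
    rw [div_le_one (by linarith)]
    linarith
  have hlip : ∀ g, IsGame (N + 2) k g → IsAnonymous (N + 2) k g →
      lipC (N + 2) k (perturbGame (N + 2) k δ g)
        ≤ (1 - δ) * (mixStep (2 * δ / k))^[N] modeProb 0 := by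
    intro g hg ha
    refine Real.sSup_le ?_ hB
    rintro _ ⟨i, a, b, hi, hab, rfl⟩
    exact abs_perturbGame_sub_le hδ0 hδ1 hg ha hi hab
  apply le_antisymm
  · refine Real.sSup_le ?_ hB
    rintro _ ⟨g, hg, ha, rfl⟩
    exact hlip g hg ha
  · let u : Fin k := ⟨0, by omega⟩
    let v : Fin k := ⟨1, by omega⟩
    let w : Fin k := ⟨2, by omega⟩
    have huv : u ≠ v := by simp [u, v]
    have hwu : w ≠ u := by simp [u, w]
    have hwv : w ≠ v := by simp [v, w]
    refine le_trans ?_ (le_csSup (s := {x | ∃ g : (Fin (N + 2) → Fin k) → Fin (N + 2) → ℝ,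
      IsGame (N + 2) k g ∧ IsAnonymous (N + 2) k g ∧
        x = lipC (N + 2) k (perturbGame (N + 2) k δ g)})
      ⟨(1 - δ) * (mixStep (2 * δ / k))^[N] modeProb 0, ?_⟩
      ⟨majorityGame (N + 2) u v, isGame_majorityGame _ _ _, isAnonymous_majorityGame _ _ _, rfl⟩)
    · refine le_csSup ⟨(1 - δ) * (mixStep (2 * δ / k))^[N] modeProb 0, ?_⟩
        ⟨0, Function.update (fun _ => w) 1 u, Function.update (fun _ => w) 1 v, ?_, ?_, ?_⟩
      · rintro _ ⟨i, a, b, hi, hab, rfl⟩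
        exact abs_perturbGame_sub_le hδ0 hδ1 (isGame_majorityGame _ _ _)
          (isAnonymous_majorityGame _ _ _) hi hab
      · simp
      · rw [Finset.card_eq_one]
        refine ⟨1, ?_⟩
        ext l
        by_cases hl : l = 1 <;> simp [hl, huv]
      · rw [perturbGame_majorityGame_sub N δ huv hwu hwv, abs_of_nonneg hB]
    · rintro _ ⟨g, hg, ha, rfl⟩
      exact hlip g hg ha

theorem mixStep_iterate_mono {p : ℝ} (hp0 : 0 ≤ p) (hp1 : p ≤ 1) {f g : ℕ → ℝ}
    (hfg : ∀ q, f q ≤ g q) (N q : ℕ) : (mixStep p)^[N] f q ≤ (mixStep p)^[N] g q := by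
  induction N generalizing q with
  | zero => exact hfg q
  | succ N ih =>
    rw [Function.iterate_succ_apply', Function.iterate_succ_apply']
    exact add_le_add (mul_le_mul_of_nonneg_left (ih _) hp0)
      (mul_le_mul_of_nonneg_left (ih _) (sub_nonneg.2 hp1))

theorem mixStep_iterate_linear (p a b : ℝ) (f g : ℕ → ℝ) (N q : ℕ) :
    (mixStep p)^[N] (fun q => a * f q + b * g q) q
      = a * (mixStep p)^[N] f q + b * (mixStep p)^[N] g q := by
  induction N generalizing q with
  | zero => rfl
  | succ N ih =>
    simp only [Function.iterate_succ_apply']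
    simp only [mixStep, ih]
    ring

theorem mixStep_iterate_affine (p a b : ℝ) (N q : ℕ) :
    (mixStep p)^[N] (fun q => a + b * q) q = a + b * (q + N * p) := by
  induction N generalizing q with
  | zero => simp
  | succ N ih =>
    rw [Function.iterate_succ_apply']
    simp only [mixStep, ih]
    push_cast
    ring

theorem mixStep_iterate_shift (p : ℝ) (f : ℕ → ℝ) (N q : ℕ) :
    (mixStep p)^[N] f (q + 1) = (mixStep p)^[N] (fun q => f (q + 1)) q := by
  induction N generalizing q with
  | zero => rfl
  | succ N ih =>
    simp only [Function.iterate_succ_apply']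
    simp only [mixStep, ih]

theorem mixStep_iterate_size_bias (p : ℝ) (f : ℕ → ℝ) (N q : ℕ) :
    (mixStep p)^[N + 1] (fun q => q * f q) q
      = q * (mixStep p)^[N + 1] f q + (N + 1) * p * (mixStep p)^[N] f (q + 1) := by
  induction N generalizing q with
  | zero =>
    simp only [zero_add, Function.iterate_one, Function.iterate_zero, id, mixStep]
    push_cast
    ring
  | succ N ih =>
    rw [Function.iterate_succ_apply', Function.iterate_succ_apply' _ (N + 1) f]
    simp only [mixStep, ih]
    rw [Function.iterate_succ_apply' _ N f]
    simp only [mixStep]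
    push_cast
    ring

theorem sq_mixStep_iterate_le {p : ℝ} (hp0 : 0 ≤ p) (hp1 : p ≤ 1) (f : ℕ → ℝ) (N q : ℕ) :
    (mixStep p)^[N] f q ^ 2 ≤ (mixStep p)^[N] (fun q => f q ^ 2) q := by
  induction N generalizing q with
  | zero => exact le_rfl
  | succ N ih =>
    rw [Function.iterate_succ_apply', Function.iterate_succ_apply']
    simp only [mixStep]
    set x := (mixStep p)^[N] f (q + 1)
    set y := (mixStep p)^[N] f q
    have h1 := mul_le_mul_of_nonneg_left (ih (q + 1)) hp0
    have h2 := mul_le_mul_of_nonneg_left (ih q) (sub_nonneg.2 hp1)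
    nlinarith [mul_nonneg (mul_nonneg hp0 (sub_nonneg.2 hp1)) (sq_nonneg (x - y))]

theorem mixStep_iterate_inv_le {p : ℝ} (hp0 : 0 < p) (hp1 : p ≤ 1) (N : ℕ) :
    (mixStep p)^[N] (fun q => 1 / ((q : ℝ) + 1)) 0 ≤ 1 / ((N + 1) * p) := by
  have h := mixStep_iterate_size_bias p (fun q => 1 / (q : ℝ)) N 0
  rw [mixStep_iterate_shift] at h
  have hle := mixStep_iterate_mono hp0.le hp1 (f := fun q => (q : ℝ) * (1 / q))
    (g := fun q => 1 + 0 * (q : ℝ)) (fun q => by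
      rcases eq_or_ne (q : ℝ) 0 with hq | hq
      · simp [hq]
      · simp [hq]) (N + 1) 0
  rw [mixStep_iterate_affine, h] at hle
  push_cast at hle
  rw [le_div_iff₀ (by positivity)]
  linarith

theorem mixStep_iterate_inv_mul_inv_le {p : ℝ} (hp0 : 0 < p) (hp1 : p ≤ 1) (N : ℕ) :
    (mixStep p)^[N] (fun q => 1 / (((q : ℝ) + 1) * (q + 2))) 0
      ≤ 1 / ((N + 1) * p * ((N + 2) * p)) := by
  have h := mixStep_iterate_size_bias p (fun q => 1 / ((q : ℝ) * (q + 1))) N 0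
  rw [mixStep_iterate_shift] at h
  have hle := mixStep_iterate_mono hp0.le hp1 (f := fun q => (q : ℝ) * (1 / (q * (q + 1))))
    (g := fun q => 1 / ((q : ℝ) + 1)) (fun q => by
      rcases eq_or_ne (q : ℝ) 0 with hq | hq
      · simp [hq]
      · field_simp
        exact le_rfl) (N + 1) 0
  have hinv := mixStep_iterate_inv_le hp0 hp1 (N + 1)
  rw [h] at hle
  push_cast at hle hinv
  simp only [add_assoc, one_add_one_eq_two] at hle hinv ⊢
  rw [mul_comm (((N : ℝ) + 1) * p), ← div_div, le_div_iff₀ (by positivity)]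
  linarith

theorem modeProb_two_mul_sq (m : ℕ) :
    modeProb (2 * m) ^ 2 = 1 / (Real.Wallis.W m * (2 * m + 1)) := by
  have h : ((2 * m).choose m : ℝ) = (2 * m).factorial / (m.factorial * m.factorial) := by
    rw [Nat.cast_choose ℝ (by omega : m ≤ 2 * m)]
    congr 4
    omega
  rw [modeProb, Nat.mul_div_cancel_left m two_pos, h, Real.Wallis.W_eq_factorial_ratio]
  have h1 : ((2 * m).factorial : ℝ) ≠ 0 := by positivity
  have h2 : (m.factorial : ℝ) ≠ 0 := by positivity
  have h3 : (2 : ℝ) ^ (4 * m) = ((2 : ℝ) ^ (2 * m)) ^ 2 := by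
    rw [← pow_mul]
    congr 1
    omega
  rw [h3]
  field_simp

theorem modeProb_odd (m : ℕ) : modeProb (2 * m + 1) = modeProb (2 * (m + 1)) := by
  have h : (2 * (m + 1)).choose (m + 1) = 2 * (2 * m + 1).choose m := by
    rw [show 2 * (m + 1) = 2 * m + 1 + 1 by omega, Nat.choose_succ_succ, Nat.choose_symm_half]
    omega
  rw [modeProb, modeProb, Nat.mul_div_cancel_left (m + 1) two_pos, h,
    show (2 * m + 1) / 2 = m by omega, show 2 * (m + 1) = 2 * m + 1 + 1 by omega,
    pow_succ _ (2 * m + 1)]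
  push_cast
  field_simp

theorem le_modeProb_sq (q : ℕ) : 2 / Real.pi / (q + 2) ≤ modeProb q ^ 2 := by
  have heven : ∀ m : ℕ, 2 / Real.pi / (2 * m + 1) ≤ modeProb (2 * m) ^ 2 := by
    intro m
    have hW := Real.Wallis.W_le m
    have hW0 := Real.Wallis.W_pos m
    rw [modeProb_two_mul_sq, ← one_div_div Real.pi 2, div_div]
    gcongr
  obtain ⟨m, rfl | rfl⟩ := Nat.even_or_odd' q
  · refine le_trans ?_ (heven m)
    have := Real.pi_pos
    push_cast
    gcongr
    norm_num
  · rw [modeProb_odd]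
    refine le_trans (le_of_eq ?_) (heven (m + 1))
    push_cast
    ring

theorem modeProb_sq_le (q : ℕ) :
    modeProb q ^ 2 ≤ 2 / Real.pi * (1 / (q + 1)) + 4 / Real.pi * (1 / ((q + 1) * (q + 2))) := by
  have hpi := Real.pi_pos
  have heven : ∀ m : ℕ, modeProb (2 * m) ^ 2 ≤ 2 / Real.pi * ((2 * m + 2) / (2 * m + 1) ^ 2) := by
    intro m
    have hW := Real.Wallis.le_W m
    have hW0 := Real.Wallis.W_pos m
    rw [modeProb_two_mul_sq]
    calc 1 / (Real.Wallis.W m * (2 * m + 1))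
        ≤ 1 / ((2 * (m : ℝ) + 1) / (2 * m + 2) * (Real.pi / 2) * (2 * m + 1)) := by gcongr
      _ = 2 / Real.pi * ((2 * m + 2) / (2 * m + 1) ^ 2) := by field_simp
  have hkey : ∀ y : ℝ, 0 ≤ y →
      (y + 2) / (y + 1) ^ 2 ≤ 1 / (y + 1) + 2 * (1 / ((y + 1) * (y + 2))) := by
    intro y hy
    rw [← sub_nonneg]
    have : 1 / (y + 1) + 2 * (1 / ((y + 1) * (y + 2))) - (y + 2) / (y + 1) ^ 2
        = y / ((y + 1) ^ 2 * (y + 2)) := by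
      field_simp
      ring
    rw [this]
    positivity
  have hsplit : 2 / Real.pi * (1 / ((q : ℝ) + 1)) + 4 / Real.pi * (1 / ((q + 1) * (q + 2)))
      = 2 / Real.pi * (1 / ((q : ℝ) + 1) + 2 * (1 / ((q + 1) * (q + 2)))) := by ring
  rw [hsplit]
  obtain ⟨m, rfl | rfl⟩ := Nat.even_or_odd' q
  · refine (heven m).trans (mul_le_mul_of_nonneg_left ?_ (by positivity))
    simpa using hkey (2 * m) (by positivity)
  · rw [modeProb_odd]
    refine (heven (m + 1)).trans (mul_le_mul_of_nonneg_left ?_ (by positivity))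
    refine (hkey _ (by positivity)).trans ?_
    push_cast
    gcongr <;> linarith

theorem tangent_le_inv_sqrt {y μ : ℝ} (hy : 0 < y) (hμ : 0 < μ) :
    (3 / 2 - y / (2 * μ)) / Real.sqrt μ ≤ 1 / Real.sqrt y := by
  obtain ⟨s, hs, rfl⟩ : ∃ s, 0 < s ∧ y = s ^ 2 :=
    ⟨Real.sqrt y, Real.sqrt_pos.2 hy, (Real.sq_sqrt hy.le).symm⟩
  obtain ⟨t, ht, rfl⟩ : ∃ t, 0 < t ∧ μ = t ^ 2 :=
    ⟨Real.sqrt μ, Real.sqrt_pos.2 hμ, (Real.sq_sqrt hμ.le).symm⟩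
  rw [Real.sqrt_sq hs.le, Real.sqrt_sq ht.le, ← sub_nonneg]
  have : 1 / s - (3 / 2 - s ^ 2 / (2 * t ^ 2)) / t
      = (t - s) ^ 2 * (2 * t + s) / (2 * s * t ^ 3) := by
    field_simp
    ring
  rw [this]
  positivity

theorem le_mixStep_iterate_modeProb {p : ℝ} (hp0 : 0 ≤ p) (hp1 : p ≤ 1) (N : ℕ) :
    Real.sqrt (2 / Real.pi / (N * p + 2)) ≤ (mixStep p)^[N] modeProb 0 := by
  have hpi := Real.pi_pos
  set μ : ℝ := N * p + 2 with hμ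
  have hμ0 : 0 < μ := by positivity
  have hline : ∀ q : ℕ, Real.sqrt (2 / Real.pi) / Real.sqrt μ * (3 / 2 - 1 / μ)
      + -(Real.sqrt (2 / Real.pi) / Real.sqrt μ / (2 * μ)) * q ≤ modeProb q := by
    intro q
    have h1 : Real.sqrt (2 / Real.pi / (q + 2)) ≤ modeProb q :=
      Real.sqrt_le_iff.2 ⟨by unfold modeProb; positivity, le_modeProb_sq q⟩
    refine le_trans ?_ h1
    rw [Real.sqrt_div (by positivity : 0 ≤ 2 / Real.pi), div_eq_mul_one_div _ (Real.sqrt ((q : ℝ) + 2))]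
    refine le_trans (le_of_eq ?_) (mul_le_mul_of_nonneg_left
      (tangent_le_inv_sqrt (by positivity : (0 : ℝ) < q + 2) hμ0) (Real.sqrt_nonneg _))
    field_simp
    ring
  refine le_trans (le_of_eq ?_) (mixStep_iterate_mono hp0 hp1 hline N 0)
  rw [mixStep_iterate_affine, Real.sqrt_div (by positivity : 0 ≤ 2 / Real.pi)]
  have : (N : ℝ) * p = μ - 2 := by rw [hμ]; ring
  rw [this]
  push_cast
  field_simp
  ring

theorem mixStep_iterate_modeProb_sq_le {p : ℝ} (hp0 : 0 < p) (hp1 : p ≤ 1) (N : ℕ) :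
    (mixStep p)^[N] modeProb 0 ^ 2
      ≤ 2 / Real.pi * (1 / ((N + 1) * p) + 2 * (1 / ((N + 1) * p * ((N + 2) * p)))) := by
  have hpi := Real.pi_pos
  refine (sq_mixStep_iterate_le hp0.le hp1 modeProb N 0).trans
    ((mixStep_iterate_mono hp0.le hp1 modeProb_sq_le N 0).trans ?_)
  rw [mixStep_iterate_linear p (2 / Real.pi) (4 / Real.pi) (fun q => 1 / ((q : ℝ) + 1))
    (fun q => 1 / (((q : ℝ) + 1) * (q + 2)))]
  have h1 := mul_le_mul_of_nonneg_left (mixStep_iterate_inv_le hp0 hp1 N)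
    (by positivity : 0 ≤ 2 / Real.pi)
  have h2 := mul_le_mul_of_nonneg_left (mixStep_iterate_inv_mul_inv_le hp0 hp1 N)
    (by positivity : 0 ≤ 4 / Real.pi)
  refine (add_le_add h1 h2).trans (le_of_eq ?_)
  ring

theorem abs_sqrt_mul_mixStep_iterate_modeProb_sub_one_le {p x : ℝ} (hp0 : 0 < p) (hp1 : p ≤ 1)
    (hx : 1 ≤ x) {N : ℕ} (hN : (N + 2) * p = 2 * x) :
    |Real.sqrt (Real.pi * x) * (mixStep p)^[N] modeProb 0 - 1| ≤ 1 / x := by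
  have hpi := Real.pi_pos
  have hx0 : 0 < x := by linarith
  have hinv : 1 / x ≤ 1 := (div_le_one hx0).2 hx
  have hinv0 : 0 < 1 / x := by positivity
  have hsq := Real.sq_sqrt (by positivity : 0 ≤ Real.pi * x)
  set B := (mixStep p)^[N] modeProb 0 with hB
  have hlow : 1 - 1 / x ≤ Real.sqrt (Real.pi * x) * B := by
    refine le_trans ?_ (mul_le_mul_of_nonneg_left
      (le_mixStep_iterate_modeProb hp0.le hp1 N) (Real.sqrt_nonneg _))
    rw [← Real.sqrt_mul (by positivity)]
    apply Real.le_sqrt_of_sq_le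
    have h1 : (N : ℝ) * p + 2 ≤ 2 * x + 2 := by linarith
    have h2 : Real.pi * x * (2 / Real.pi / (2 * x + 2))
        ≤ Real.pi * x * (2 / Real.pi / (N * p + 2)) := by gcongr
    refine le_trans ?_ h2
    have h3 : Real.pi * x * (2 / Real.pi / (2 * x + 2)) = 1 - 1 / (x + 1) := by
      field_simp
      ring
    have h4 : 1 / (x + 1) ≤ 1 / x := by gcongr; linarith
    rw [h3]
    nlinarith
  have hup : Real.sqrt (Real.pi * x) * B ≤ 1 + 1 / x := by
    refine le_of_sq_le_sq ?_ (by positivity)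
    have hsucc : x + 1 ≤ (N : ℝ) + 2 := by nlinarith
    have h1 := mul_le_mul_of_nonneg_left (mixStep_iterate_modeProb_sq_le hp0 hp1 N)
      (by positivity : 0 ≤ Real.pi * x)
    rw [mul_pow, hsq]
    refine h1.trans ?_
    rw [hN]
    have h2 : Real.pi * x * (2 / Real.pi * (1 / ((N + 1) * p) + 2 * (1 / ((N + 1) * p * (2 * x)))))
        = 2 * x / ((N + 1) * p) * (1 + 1 / x) := by
      field_simp
    have h3 : 2 * x / ((N + 1) * p) = 1 + 1 / ((N : ℝ) + 1) := by
      rw [← hN]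
      field_simp
      ring
    have h4 : 1 / ((N : ℝ) + 1) ≤ 1 / x := by gcongr; linarith
    rw [h2, h3, sq]
    gcongr
  rw [abs_le]
  constructor <;> linarith

/-- As `nδ/k → ∞` (with `k ≥ 3`), `(1-δ)⁻¹·√(πnδ/k)·λ(n,k,δ) → 1`. -/
theorem lipschitz_constant_asymptotics (ε : ℝ) (hε : 0 < ε) :
    ∃ M : ℝ, ∀ (n k : ℕ) (δ : ℝ), 2 ≤ n → 3 ≤ k → δ ∈ Set.Ioo (0 : ℝ) 1 →
      M ≤ (n : ℝ) * δ / k →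
      |(1 - δ)⁻¹ * Real.sqrt (Real.pi * n * δ / k) * lam n k δ - 1| < ε := by
  refine ⟨1 / ε + 1, fun n k δ hn hk hδ hM => ?_⟩
  obtain ⟨hδ0, hδ1⟩ := hδ
  obtain ⟨N, rfl⟩ := Nat.exists_eq_add_of_le' hn
  have hk' : (3 : ℝ) ≤ k := by exact_mod_cast hk
  have hε' : 0 < 1 / ε := by positivity
  have hp1 : 2 * δ / k ≤ 1 := by
    rw [div_le_one (by linarith)]
    linarith
  have h := abs_sqrt_mul_mixStep_iterate_modeProb_sub_one_le (p := 2 * δ / k)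
    (x := ((N + 2 : ℕ) : ℝ) * δ / k) (by positivity) hp1 (by linarith) (N := N)
    (by push_cast; ring)
  have hδ' : (1 : ℝ) - δ ≠ 0 := by linarith
  have heq : (1 - δ)⁻¹ * Real.sqrt (Real.pi * (N + 2 : ℕ) * δ / k) * lam (N + 2) k δ
      = Real.sqrt (Real.pi * (((N + 2 : ℕ) : ℝ) * δ / k))
        * (mixStep (2 * δ / k))^[N] modeProb 0 := by
    rw [lam_eq hk hδ0.le hδ1.le,
      show Real.pi * (N + 2 : ℕ) * δ / k = Real.pi * (((N + 2 : ℕ) : ℝ) * δ / k) by ring]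
    field_simp
  rw [heq]
  exact h.trans_lt (by rw [one_div_lt (by linarith) hε]; linarith)
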